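/- Let X be an L-convex space and ξ_X : X → X^F the map ξ_X(x) = co(1_x). Then X is sober if and only if ξ_X is a convex-homeomorphism (a bijection that is both convexity-preserving and convex-to-convex). -/

import Mathlib

universe u v w u'

/-- A complete residuated lattice: a complete lattice with a commutative monoid
operation `tens` whose unit is the top element and which distributes over
arbitrary joins; `himp` is its residuation. -/
class CRL (L : Type u) extends CompleteLattice L where
  tens : L → L → L
  himp : L → L → L
  tens_comm : ∀ a b : L, tens a b = tens b a
  tens_assoc : ∀ a b c : L, tens (tens a b) c = tens a (tens b c)
  tens_top : ∀ a : L, tens a ⊤ = a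
  tens_sSup : ∀ (a : L) (S : Set L), tens a (sSup S) = ⨆ b ∈ S, tens a b
  tens_le_iff_le_himp : ∀ a b c : L, tens a b ≤ c ↔ a ≤ himp b c

namespace CRL

variable {L : Type u} [CRL L]

lemma le_himp_iff {a b c : L} : a ≤ himp b c ↔ tens a b ≤ c :=
  (tens_le_iff_le_himp a b c).symm

lemma tens_himp_le (b c : L) : tens (himp b c) b ≤ c := le_himp_iff.mp le_rfl

lemma tens_mono_right (a : L) {b c : L} (h : b ≤ c) : tens a b ≤ tens a c := by
  have h1 : sSup ({b, c} : Set L) = c := by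
    apply le_antisymm (sSup_le ?_) (le_sSup (by simp))
    rintro x (rfl | rfl)
    · exact h
    · exact le_rfl
  have h2 : tens a b ≤ ⨆ x ∈ ({b, c} : Set L), tens a x :=
    le_biSup _ (by simp)
  calc tens a b ≤ ⨆ x ∈ ({b, c} : Set L), tens a x := h2
    _ = tens a (sSup {b, c}) := (tens_sSup a _).symm
    _ = tens a c := by rw [h1]

lemma tens_mono_left {a b : L} (c : L) (h : a ≤ b) : tens a c ≤ tens b c := by
  rw [tens_comm a c, tens_comm b c]; exact tens_mono_right c h

lemma himp_le_himp_right (a : L) {b c : L} (h : b ≤ c) : himp a b ≤ himp a c :=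
  le_himp_iff.mpr (le_trans (tens_himp_le a b) h)

lemma himp_le_himp_left {a b : L} (c : L) (h : a ≤ b) : himp b c ≤ himp a c :=
  le_himp_iff.mpr (le_trans (tens_mono_right _ h) (tens_himp_le b c))

lemma tens_bot (a : L) : tens a ⊥ = ⊥ := by
  have := tens_sSup a ∅
  simpa using this

lemma top_himp (a : L) : himp ⊤ a = a := by
  apply le_antisymm
  · have := tens_himp_le (⊤ : L) a
    rwa [tens_top] at this
  · exact le_himp_iff.mpr (by rw [tens_top])

lemma bot_himp (a : L) : himp ⊥ a = ⊤ :=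
  le_antisymm le_top (le_himp_iff.mpr (by rw [tens_bot]; exact bot_le))

lemma tens_iSup {ι : Sort w} (a : L) (f : ι → L) :
    tens a (⨆ i, f i) = ⨆ i, tens a (f i) := by
  rw [iSup, tens_sSup, iSup_range]

lemma himp_iSup_left {ι : Sort w} (f : ι → L) (c : L) :
    himp (⨆ i, f i) c = ⨅ i, himp (f i) c := by
  apply le_antisymm
  · exact le_iInf fun i => himp_le_himp_left c (le_iSup f i)
  · apply le_himp_iff.mpr
    rw [tens_iSup]
    apply iSup_le
    intro i
    exact le_trans (tens_mono_left _ (iInf_le _ i)) (tens_himp_le _ _)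

/-! ### L-subsets -/

/-- The fuzzy inclusion order on `L`-subsets. -/
def fsub {X : Type v} (A B : X → L) : L := ⨅ x, himp (A x) (B x)

/-- A nonempty `L`-subset. -/
def NonemptyL {X : Type v} (A : X → L) : Prop := (⨆ x, A x) = ⊤

/-- A finite `L`-subset. -/
def FinL {X : Type v} (F : X → L) : Prop :=
  ∀ D : Set (X → L), D.Nonempty → DirectedOn (· ≤ ·) D →
    fsub F (sSup D) = ⨆ A ∈ D, fsub F A

open Classical in
/-- Characteristic function of a crisp subset. -/
noncomputable def chi {X : Type v} (Z : Set X) : X → L :=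
  fun x => if x ∈ Z then ⊤ else ⊥

/-- Characteristic function of a point. -/
noncomputable def single {X : Type v} (x : X) : X → L := chi {x}

/-! ### L-convex structures -/

/-- A (stratified) `L`-convex structure on `X`. -/
def IsConvexStruct {X : Type v} (𝒞 : Set (X → L)) : Prop :=
  (fun _ => (⊥ : L)) ∈ 𝒞 ∧ (fun _ => (⊤ : L)) ∈ 𝒞 ∧
  (∀ D ⊆ 𝒞, D.Nonempty → DirectedOn (· ≤ ·) D → sSup D ∈ 𝒞) ∧
  (∀ D ⊆ 𝒞, sInf D ∈ 𝒞) ∧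
  (∀ (a : L), ∀ C ∈ 𝒞, (fun x => himp a (C x)) ∈ 𝒞)

/-- The hull operator of an `L`-convex structure. -/
def hull {X : Type v} (𝒞 : Set (X → L)) (A : X → L) : X → L :=
  sInf {B | B ∈ 𝒞 ∧ A ≤ B}

/-- Sobriety of an `L`-convex space. -/
def Sober {X : Type v} (𝒞 : Set (X → L)) : Prop :=
  ∀ F : X → L, NonemptyL F → FinL F → ∃! x : X, hull 𝒞 F = hull 𝒞 (single x)

/-- Compact (algebraic irreducible) convex sets. -/
def IsCompactConvex {X : Type v} (𝒞 : Set (X → L)) (K : X → L) : Prop :=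
  K ∈ 𝒞 ∧ NonemptyL K ∧
  ∀ D ⊆ 𝒞, D.Nonempty → DirectedOn (· ≤ ·) D →
    fsub K (sSup D) = ⨆ C ∈ D, fsub K C

/-- Convexity-preserving maps. -/
def ConvPres {X : Type v} {Y : Type w} (𝒞X : Set (X → L)) (𝒞Y : Set (Y → L))
    (f : X → Y) : Prop :=
  ∀ B ∈ 𝒞Y, (B ∘ f) ∈ 𝒞X

/-- The Zadeh (forward) extension of a map. -/
def zimg {X : Type v} {Y : Type w} (f : X → Y) (A : X → L) : Y → L :=
  fun y => ⨆ x ∈ {x | f x = y}, A x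

/-- Convex-to-convex maps. -/
def ConvToConv {X : Type v} {Y : Type w} (𝒞X : Set (X → L)) (𝒞Y : Set (Y → L))
    (f : X → Y) : Prop :=
  ∀ A ∈ 𝒞X, zimg f A ∈ 𝒞Y

/-- F-closed crisp subsets of an `L`-convex space. -/
def FClosed {X : Type v} (𝒞 : Set (X → L)) (A : Set X) : Prop :=
  ∀ F : X → L, NonemptyL F → FinL F → F ≤ chi A →
    ∀ x : X, hull 𝒞 F = hull 𝒞 (single x) → x ∈ A

/-- F-closure of a crisp subset. -/
def fcl {X : Type v} (𝒞 : Set (X → L)) (Z : Set X) : Set X :=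
  ⋂₀ {A : Set X | FClosed 𝒞 A ∧ Z ⊆ A}

/-- The `S₀` separation axiom. -/
def S0 {X : Type v} (𝒞 : Set (X → L)) : Prop :=
  ∀ x y : X, hull 𝒞 (single x) = hull 𝒞 (single y) → x = y

/-- The set of compact convex sets, as a type. -/
abbrev cpT {X : Type v} (𝒞 : Set (X → L)) : Type _ :=
  {K : X → L // IsCompactConvex 𝒞 K}

/-- `φ(A)(K) = sub(K, A)`. -/
def phi {X : Type v} (𝒞 : Set (X → L)) (A : X → L) : cpT 𝒞 → L :=
  fun K => fsub K.1 A

/-- The convex structure `{φ(A) | A ∈ 𝒞}` on `cp(𝒞)`. -/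
def cpStruct {X : Type v} (𝒞 : Set (X → L)) : Set (cpT 𝒞 → L) :=
  {Φ | ∃ A ∈ 𝒞, Φ = phi 𝒞 A}

/-- `Θ(X) = {co(1ₓ) | x ∈ X}` as a subset of `cp(𝒞)`. -/
def Theta {X : Type v} (𝒞 : Set (X → L)) : Set (cpT 𝒞) :=
  {K | ∃ x : X, (K : X → L) = hull 𝒞 (single x)}

/-- `X^F`: the F-closure of `Θ(X)` in `Cp(𝒞)`. -/
def XF {X : Type v} (𝒞 : Set (X → L)) : Set (cpT 𝒞) :=
  fcl (cpStruct 𝒞) (Theta 𝒞)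

/-- `X^F` as a type. -/
abbrev XFT {X : Type v} (𝒞 : Set (X → L)) : Type _ :=
  {K : cpT 𝒞 // K ∈ XF 𝒞}

/-- The restriction `φ(A)|_{X^F}`. -/
def phiF {X : Type v} (𝒞 : Set (X → L)) (A : X → L) : XFT 𝒞 → L :=
  fun K => fsub K.1.1 A

/-- The convex structure `{φ(A)|_{X^F} | A ∈ 𝒞}` on `X^F`. -/
def xfStruct {X : Type v} (𝒞 : Set (X → L)) : Set (XFT 𝒞 → L) :=
  {Φ | ∃ A ∈ 𝒞, Φ = phiF 𝒞 A}

/-- The specialization `L`-order of an `L`-convex space. -/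
def specOrd {X : Type v} (𝒞 : Set (X → L)) (x y : X) : L :=
  ⨅ A ∈ 𝒞, himp (A y) (A x)

/-! ### basic lemmas -/

lemma single_apply_self {X : Type v} (x : X) : (single x : X → L) x = ⊤ := by
  simp [single, chi]

lemma le_hull {X : Type v} (𝒞 : Set (X → L)) (A : X → L) : A ≤ hull 𝒞 A :=
  le_sInf fun B hB => hB.2

lemma hull_mem {X : Type v} {𝒞 : Set (X → L)} (hC : IsConvexStruct 𝒞)
    (A : X → L) : hull 𝒞 A ∈ 𝒞 :=
  hC.2.2.2.1 _ fun B hB => hB.1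

lemma fsub_anti_left {X : Type v} {A B : X → L} (C : X → L) (h : A ≤ B) :
    fsub B C ≤ fsub A C :=
  le_iInf fun x => le_trans (iInf_le _ x) (himp_le_himp_left _ (h x))

lemma fsub_mono_right {X : Type v} (A : X → L) {B C : X → L} (h : B ≤ C) :
    fsub A B ≤ fsub A C :=
  le_iInf fun x => le_trans (iInf_le _ x) (himp_le_himp_right _ (h x))

lemma fsub_single {X : Type v} (x : X) (C : X → L) :
    fsub (single x) C = C x := by
  apply le_antisymm
  · refine le_trans (iInf_le _ x) ?_
    rw [single_apply_self, top_himp]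
  · apply le_iInf
    intro y
    by_cases h : y = x
    · subst h
      rw [single_apply_self, top_himp]
    · have hy : (single x : X → L) y = ⊥ := by simp [single, chi, h]
      rw [hy, bot_himp]
      exact le_top

lemma sSup_apply_mem {X : Type v} (D : Set (X → L)) (x : X) :
    sSup D x = ⨆ A ∈ D, A x := by
  rw [sSup_apply]
  apply le_antisymm
  · exact iSup_le fun f => le_biSup (fun A => A x) f.2
  · exact iSup₂_le fun A hA => le_iSup_of_le ⟨A, hA⟩ le_rfl

lemma fsub_hull {X : Type v} {𝒞 : Set (X → L)} (hC : IsConvexStruct 𝒞)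
    (A : X → L) {B : X → L} (hB : B ∈ 𝒞) :
    fsub (hull 𝒞 A) B = fsub A B := by
  apply le_antisymm
  · exact fsub_anti_left _ (le_hull 𝒞 A)
  · set s := fsub A B with hs
    have hmem : (fun x => himp s (B x)) ∈ 𝒞 := hC.2.2.2.2 s B hB
    have hA : A ≤ fun x => himp s (B x) := by
      intro x
      have h1 : s ≤ himp (A x) (B x) := iInf_le _ x
      have h2 : tens s (A x) ≤ B x := le_himp_iff.mp h1
      have h3 : tens (A x) s ≤ B x := by rwa [tens_comm]
      exact le_himp_iff.mpr h3
    have hle : hull 𝒞 A ≤ fun x => himp s (B x) := sInf_le ⟨hmem, hA⟩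
    apply le_iInf
    intro x
    have h5 : tens (hull 𝒞 A x) s ≤ B x := le_himp_iff.mp (hle x)
    have h4 : tens s (hull 𝒞 A x) ≤ B x := by rwa [tens_comm]
    exact le_himp_iff.mpr h4

lemma hull_single_compact {X : Type v} {𝒞 : Set (X → L)}
    (hC : IsConvexStruct 𝒞) (x : X) :
    IsCompactConvex 𝒞 (hull 𝒞 (single x)) := by
  refine ⟨hull_mem hC _, ?_, ?_⟩
  · apply le_antisymm le_top
    calc (⊤ : L) = single x x := (single_apply_self x).symm
      _ ≤ hull 𝒞 (single x) x := le_hull 𝒞 _ x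
      _ ≤ ⨆ y, hull 𝒞 (single x) y := le_iSup _ x
  · intro D hD hne hdir
    rw [fsub_hull hC _ (hC.2.2.1 D hD hne hdir), fsub_single, sSup_apply_mem]
    apply le_antisymm
    · refine iSup₂_le fun A hA => ?_
      have : fsub (hull 𝒞 (single x)) A = A x := by
        rw [fsub_hull hC _ (hD hA), fsub_single]
      exact le_trans (le_of_eq this.symm) (le_biSup _ hA)
    · refine iSup₂_le fun A hA => ?_
      have : fsub (hull 𝒞 (single x)) A = A x := by
        rw [fsub_hull hC _ (hD hA), fsub_single]
      rw [this]
      exact le_biSup (fun A => A x) hA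

/-- `Θ(X) ⊆ X^F`. -/
lemma Theta_subset_XF {X : Type v} (𝒞 : Set (X → L)) : Theta 𝒞 ⊆ XF 𝒞 :=
  fun K hK => Set.mem_sInter.mpr fun _ hA => hA.2 hK

/-- The canonical map `ξ_X : X → X^F`, `ξ_X(x) = co(1ₓ)`. -/
noncomputable def xi {X : Type v} {𝒞 : Set (X → L)} (hC : IsConvexStruct 𝒞)
    (x : X) : XFT 𝒞 :=
  ⟨⟨hull 𝒞 (single x), hull_single_compact hC x⟩, Theta_subset_XF 𝒞 ⟨x, rfl⟩⟩

/-! ### L-orders -/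

/-- An `L`-order. -/
structure IsLOrder {P : Type v} (e : P → P → L) : Prop where
  refl : ∀ x, e x x = ⊤
  trans : ∀ x y z, tens (e x y) (e y z) ≤ e x z
  antisymm : ∀ x y, e x y ⊓ e y x = ⊤ → x = y

/-- Lower `L`-subsets. -/
def LowerL {P : Type v} (e : P → P → L) (S : P → L) : Prop :=
  ∀ x y, tens (S x) (e y x) ≤ S y

/-- `s` is the supremum of the `L`-subset `A`. -/
def IsSupL {P : Type v} (e : P → P → L) (A : P → L) (s : P) : Prop :=
  ∀ y, e s y = fsub A (fun z => e z y)

/-- Scott convex `L`-subsets. -/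
def ScottConvex {P : Type v} (e : P → P → L) (A : P → L) : Prop :=
  LowerL e A ∧
  ∀ F : P → L, NonemptyL F → FinL F → ∀ s, IsSupL e F s → fsub F A ≤ A s

/-- The Scott `L`-convex structure `σ*(P)`. -/
def scottStruct {P : Type v} (e : P → P → L) : Set (P → L) :=
  {A | ScottConvex e A}

/-- `L`-join-semilattices. -/
def LJoinSemilat {P : Type v} (e : P → P → L) : Prop :=
  ∀ F : P → L, NonemptyL F → FinL F → ∃ s, IsSupL e F s

/-- `L`-order-preserving maps. -/
def OrdPres {P : Type v} {Q : Type w} (eP : P → P → L) (eQ : Q → Q → L)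
    (f : P → Q) : Prop :=
  ∀ x y, eP x y ≤ eQ (f x) (f y)

/-- Scott convexity-preserving maps. -/
def ScottCP {P : Type v} {Q : Type w} (eP : P → P → L) (eQ : Q → Q → L)
    (f : P → Q) : Prop :=
  OrdPres eP eQ f ∧
  ∀ F : P → L, NonemptyL F → FinL F →
    ∀ s, IsSupL eP F s → IsSupL eQ (zimg f F) (f s)

/-- Sobrification of an `L`-convex space. -/
def IsSobrification {X : Type v} {Y : Type w} (𝒞X : Set (X → L))
    (𝒞Y : Set (Y → L)) (j : X → Y) : Prop :=
  IsConvexStruct 𝒞Y ∧ Sober 𝒞Y ∧ ConvPres 𝒞X 𝒞Y j ∧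
  ∀ (Z : Type u') (𝒞Z : Set (Z → L)), IsConvexStruct 𝒞Z → Sober 𝒞Z →
    ∀ f : X → Z, ConvPres 𝒞X 𝒞Z f →
      ∃! g : Y → Z, ConvPres 𝒞Y 𝒞Z g ∧ f = g ∘ j

/-- `L`-join-semilattice completion. -/
def IsLJSCompletion {P : Type v} {Q : Type w} (eP : P → P → L)
    (eQ : Q → Q → L) (j : P → Q) : Prop :=
  IsLOrder eQ ∧ LJoinSemilat eQ ∧ ScottCP eP eQ j ∧
  ∀ (M : Type u') (eM : M → M → L), IsLOrder eM → LJoinSemilat eM →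
    ∀ f : P → M, ScottCP eP eM f →
      ∃! g : Q → M, ScottCP eQ eM g ∧ f = g ∘ j

/-- `σ*(P)` is an `L`-convex structure. -/
lemma scottStruct_isConvexStruct {P : Type v} (e : P → P → L) :
    IsConvexStruct (scottStruct e) := by
  refine ⟨⟨?_, ?_⟩, ⟨?_, ?_⟩, ?_, ?_, ?_⟩
  · intro x y
    rw [tens_comm, tens_bot]
  · intro F hF _ s _
    have h1 : fsub F (fun _ => (⊥ : L)) = himp (⨆ x, F x) ⊥ := by
      rw [himp_iSup_left]; rfl
    rw [h1, hF, top_himp]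
  · intro x y
    exact le_top
  · intro F _ _ s _
    exact le_top
  · -- directed joins
    intro D hD hne hdir
    constructor
    · intro x y
      apply le_himp_iff.mp
      rw [sSup_apply_mem]
      refine iSup₂_le fun A hA => le_himp_iff.mpr ?_
      exact le_trans ((hD hA).1 x y) (by rw [sSup_apply_mem]; exact le_biSup (fun A => A y) hA)
    · intro F hF hFin s hs
      rw [hFin D hne hdir, sSup_apply_mem]
      exact iSup₂_le fun A hA =>
        le_trans ((hD hA).2 F hF hFin s hs) (le_biSup (fun A => A s) hA)
  · -- arbitrary meets
    intro D hD
    constructor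
    · intro x y
      rw [sInf_apply, sInf_apply]
      apply le_iInf
      intro A
      exact le_trans (tens_mono_left _ (iInf_le _ A)) ((hD A.2).1 x y)
    · intro F hF hFin s hs
      rw [sInf_apply]
      apply le_iInf
      intro A
      refine le_trans (fsub_mono_right F ?_) ((hD A.2).2 F hF hFin s hs)
      intro x
      rw [sInf_apply]
      exact iInf_le _ A
  · -- himp closure
    intro a C hC
    constructor
    · intro x y
      apply le_himp_iff.mpr
      have h1 : tens (tens (himp a (C x)) (e y x)) a
          = tens (tens (himp a (C x)) a) (e y x) := by
        rw [tens_assoc, tens_comm (e y x) a, ← tens_assoc]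
      rw [h1]
      exact le_trans (tens_mono_left _ (tens_himp_le a (C x))) (hC.1 x y)
    · intro F hF hFin s hs
      apply le_himp_iff.mpr
      refine le_trans ?_ (hC.2 F hF hFin s hs)
      apply le_iInf
      intro x
      apply le_himp_iff.mpr
      have h1 : tens (tens (fsub F (fun x => himp a (C x))) a) (F x)
          = tens (tens (fsub F (fun x => himp a (C x))) (F x)) a := by
        rw [tens_assoc, tens_comm a (F x), ← tens_assoc]
      rw [h1]
      have h2 : tens (fsub F (fun x => himp a (C x))) (F x) ≤ himp a (C x) :=
        le_trans (tens_mono_left _ (iInf_le _ x)) (tens_himp_le _ _)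
      exact le_trans (tens_mono_left _ h2) (tens_himp_le a (C x))

lemma fsub_eq_top_iff {X : Type v} {A B : X → L} : fsub A B = ⊤ ↔ A ≤ B := by
  have key (x : X) : himp (A x) (B x) = ⊤ ↔ A x ≤ B x := by
    rw [eq_top_iff, le_himp_iff, tens_comm, tens_top]
  simp only [fsub, iInf_eq_top, key, Pi.le_def]

lemma hull_eq_of_fsub_eq {X : Type v} {𝒞 : Set (X → L)} {F G : X → L}
    (h : ∀ B ∈ 𝒞, fsub F B = fsub G B) : hull 𝒞 F = hull 𝒞 G := by
  unfold hull
  congr 1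
  ext B
  simp only [Set.mem_ofPred_eq, and_congr_right_iff]
  intro hB
  rw [← fsub_eq_top_iff, ← fsub_eq_top_iff, h B hB]

lemma eq_of_fsub_eq {X : Type v} {𝒞 : Set (X → L)} {K M : X → L} (hK : K ∈ 𝒞) (hM : M ∈ 𝒞)
    (h : ∀ B ∈ 𝒞, fsub K B = fsub M B) : K = M :=
  le_antisymm (fsub_eq_top_iff.mp ((h M hM).trans (fsub_eq_top_iff.mpr le_rfl)))
    (fsub_eq_top_iff.mp ((h K hK).symm.trans (fsub_eq_top_iff.mpr le_rfl)))

lemma himp_iInf_right {ι : Sort w} (a : L) (f : ι → L) :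
    himp a (⨅ i, f i) = ⨅ i, himp a (f i) := by
  refine le_antisymm (le_iInf fun i => himp_le_himp_right a (iInf_le f i)) ?_
  rw [le_himp_iff]
  exact le_iInf fun i => le_himp_iff.mp (iInf_le _ i)

lemma himp_himp_comm (a b c : L) : himp a (himp b c) = himp b (himp a c) := by
  refine eq_of_forall_le_iff fun d => ?_
  rw [le_himp_iff, le_himp_iff, le_himp_iff, le_himp_iff, tens_assoc, tens_comm a b, tens_assoc]

lemma fsub_sInf {X : Type v} (K : X → L) (D : Set (X → L)) :
    fsub K (sInf D) = ⨅ A ∈ D, fsub K A := by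
  refine eq_of_forall_le_iff fun d => ?_
  simp only [fsub, sInf_apply, himp_iInf_right, le_iInf_iff, Subtype.forall]
  exact ⟨fun h A hA x => h x A hA, fun h x A hA => h A hA x⟩

lemma fsub_himp_right {X : Type v} (K : X → L) (a : L) (A : X → L) :
    fsub K (fun x => himp a (A x)) = himp a (fsub K A) := by
  simp only [fsub, himp_iInf_right]
  exact iInf_congr fun x => himp_himp_comm _ _ _

lemma fsub_bot_of_nonemptyL {X : Type v} {K : X → L} (hK : NonemptyL K) :
    fsub K (fun _ => (⊥ : L)) = ⊥ := by
  rw [show fsub K (fun _ => (⊥ : L)) = himp (⨆ x, K x) ⊥ from (himp_iSup_left _ _).symm,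
    hK, top_himp]

lemma finL_single {X : Type v} (x : X) : FinL (single x : X → L) := by
  intro D _ _
  simp only [fsub_single, sSup_apply_mem]

lemma nonemptyL_single {X : Type v} (x : X) : NonemptyL (single x : X → L) :=
  top_le_iff.mp ((single_apply_self x).ge.trans (le_iSup (single x : X → L) x))

lemma NonemptyL.mono {X : Type v} {A B : X → L} (hA : NonemptyL A) (h : A ≤ B) : NonemptyL B :=
  top_le_iff.mp (hA.ge.trans (iSup_mono h))

lemma isCompactConvex_hull {X : Type v} {𝒞 : Set (X → L)} (hC : IsConvexStruct 𝒞)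
    {F : X → L} (hF : NonemptyL F) (hFin : FinL F) : IsCompactConvex 𝒞 (hull 𝒞 F) := by
  refine ⟨hull_mem hC F, hF.mono (le_hull 𝒞 F), fun D hD hne hdir => ?_⟩
  rw [fsub_hull hC F (hC.2.2.1 D hD hne hdir), hFin D hne hdir]
  exact biSup_congr fun A hA => (fsub_hull hC F (hD hA)).symm

/-! ### Zadeh extensions -/

lemma fsub_zimg {X : Type v} {Y : Type w} (f : X → Y) (F : X → L) (B : Y → L) :
    fsub (zimg f F) B = fsub F (B ∘ f) := by
  simp only [fsub, zimg, himp_iSup_left, Function.comp_apply, Set.mem_ofPred_eq]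
  rw [iInf_comm]
  refine iInf_congr fun x => ?_
  rw [iInf_iInf_eq_right]

lemma zimg_apply_of_injective {X : Type v} {Y : Type w} {f : X → Y} (hf : Function.Injective f)
    (A : X → L) (x : X) : zimg f A (f x) = A x := by
  simp only [zimg, Set.mem_ofPred_eq, hf.eq_iff, iSup_iSup_eq_left]

lemma zimg_comp_of_injective {X : Type v} {Y : Type w} {f : X → Y} (hf : Function.Injective f)
    (A : X → L) : zimg f A ∘ f = A :=
  funext (zimg_apply_of_injective hf A)

lemma zimg_le_chi {X : Type v} {Y : Type w} {f : X → Y} {Z : Set Y} (h : ∀ x, f x ∈ Z)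
    (F : X → L) : zimg f F ≤ chi Z := by
  intro y
  refine iSup₂_le fun x (hx : f x = y) => ?_
  simp [chi, hx ▸ h x]

lemma zimg_mono {X : Type v} {Y : Type w} (f : X → Y) :
    Monotone (zimg f : (X → L) → (Y → L)) :=
  fun _ _ h _ => iSup₂_mono fun x _ => h x

lemma zimg_comp_of_le_chi_range {X : Type v} {Y : Type w} {f : X → Y} {Z : Set Y} {G : Y → L}
    (hG : G ≤ chi Z) (hZ : Z ⊆ Set.range f) : zimg f (G ∘ f) = G := by
  refine funext fun y => le_antisymm (iSup₂_le fun x (hx : f x = y) => by simp [hx]) ?_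
  by_cases hy : y ∈ Z
  · obtain ⟨x, rfl⟩ := hZ hy
    exact le_biSup (G ∘ f) (show x ∈ {x' | f x' = f x} from rfl)
  · exact (hG y).trans (by simp [chi, hy])

lemma iSup_zimg {X : Type v} {Y : Type w} (f : X → Y) (F : X → L) :
    ⨆ y, zimg f F y = ⨆ x, F x := by
  simp only [zimg, Set.mem_ofPred_eq]
  rw [iSup_comm]
  exact iSup_congr fun x => iSup_iSup_eq_right

lemma nonemptyL_zimg_iff {X : Type v} {Y : Type w} {f : X → Y} {F : X → L} :
    NonemptyL (zimg f F) ↔ NonemptyL F := by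
  rw [NonemptyL, NonemptyL, iSup_zimg]

lemma FinL.zimg {X : Type v} {Y : Type w} (f : X → Y) {F : X → L} (hF : FinL F) :
    FinL (zimg f F) := by
  intro D hne hdir
  have hcomp : sSup D ∘ f = sSup ((fun B : Y → L => B ∘ f) '' D) := by
    funext x
    rw [Function.comp_apply, sSup_apply_mem, sSup_apply_mem, iSup_image]
    rfl
  have hdir' : DirectedOn (· ≤ ·) ((fun B : Y → L => B ∘ f) '' D) :=
    hdir.mono_comp fun _ _ h x => h (f x)
  rw [fsub_zimg, hcomp, hF _ (hne.image _) hdir', iSup_image]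
  simp only [fsub_zimg]

lemma FinL.of_zimg {X : Type v} {Y : Type w} {f : X → Y} (hf : Function.Injective f) {F : X → L}
    (hF : FinL (CRL.zimg f F)) : FinL F := by
  have key (A : X → L) : fsub F A = fsub (CRL.zimg f F) (CRL.zimg f A) := by
    rw [fsub_zimg, zimg_comp_of_injective hf]
  intro D hne hdir
  have hcomp : sSup D = sSup (CRL.zimg f '' D) ∘ f := by
    funext x
    rw [Function.comp_apply, sSup_apply_mem, sSup_apply_mem, iSup_image]
    simp only [zimg_apply_of_injective hf]
  rw [hcomp, ← fsub_zimg, hF _ (hne.image _) (hdir.mono_comp (zimg_mono f)), iSup_image]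
  simp only [key]

/-! ### The space of compact convex sets -/

lemma phi_hull_single {X : Type v} {𝒞 : Set (X → L)} (hC : IsConvexStruct 𝒞) {A : X → L}
    (hA : A ∈ 𝒞) (x : X) : phi 𝒞 A (xi hC x).1 = A x :=
  (fsub_hull hC _ hA).trans (fsub_single x A)

lemma phi_le_phi_iff {X : Type v} {𝒞 : Set (X → L)} (hC : IsConvexStruct 𝒞) {A B : X → L}
    (hA : A ∈ 𝒞) (hB : B ∈ 𝒞) : phi 𝒞 A ≤ phi 𝒞 B ↔ A ≤ B := by
  refine ⟨fun h x => ?_, fun h K => fsub_mono_right _ h⟩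
  rw [← phi_hull_single hC hA x, ← phi_hull_single hC hB x]
  exact h _

lemma exists_eq_image_phi {X : Type v} {𝒞 : Set (X → L)} {D : Set (cpT 𝒞 → L)}
    (hD : D ⊆ cpStruct 𝒞) : ∃ E ⊆ 𝒞, D = phi 𝒞 '' E := by
  refine ⟨{A | A ∈ 𝒞 ∧ phi 𝒞 A ∈ D}, fun A hA => hA.1, ?_⟩
  ext Φ
  constructor
  · intro hΦ
    obtain ⟨A, hA, rfl⟩ := hD hΦ
    exact ⟨A, ⟨hA, hΦ⟩, rfl⟩
  · rintro ⟨A, ⟨-, hA⟩, rfl⟩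
    exact hA

lemma isConvexStruct_cpStruct {X : Type v} {𝒞 : Set (X → L)} (hC : IsConvexStruct 𝒞) :
    IsConvexStruct (cpStruct 𝒞) := by
  refine ⟨⟨_, hC.1, ?_⟩, ⟨_, hC.2.1, ?_⟩, ?_, ?_, ?_⟩
  · exact funext fun K => (fsub_bot_of_nonemptyL K.2.2.1).symm
  · exact funext fun K => (fsub_eq_top_iff.mpr fun _ => le_top).symm
  · intro D hD hne hdir
    obtain ⟨E, hE, rfl⟩ := exists_eq_image_phi hD
    have hEdir : DirectedOn (· ≤ ·) E := by
      intro A hA B hB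
      obtain ⟨-, ⟨M, hM, rfl⟩, hAM, hBM⟩ := hdir _ ⟨A, hA, rfl⟩ _ ⟨B, hB, rfl⟩
      exact ⟨M, hM, (phi_le_phi_iff hC (hE hA) (hE hM)).mp hAM,
        (phi_le_phi_iff hC (hE hB) (hE hM)).mp hBM⟩
    have hEne := Set.image_nonempty.mp hne
    refine ⟨sSup E, hC.2.2.1 E hE hEne hEdir, funext fun K => ?_⟩
    rw [sSup_apply_mem, iSup_image]
    exact (K.2.2.2 E hE hEne hEdir).symm
  · intro D hD
    obtain ⟨E, hE, rfl⟩ := exists_eq_image_phi hD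
    refine ⟨sInf E, hC.2.2.2.1 E hE, funext fun K => ?_⟩
    rw [sInf_image, iInf_apply]
    simp only [iInf_apply]
    exact (fsub_sInf K.1 E).symm
  · rintro a _ ⟨A, hA, rfl⟩
    exact ⟨_, hC.2.2.2.2 a A hA, funext fun K => (fsub_himp_right K.1 a A).symm⟩

lemma phi_comp_xi {X : Type v} {𝒞 : Set (X → L)} (hC : IsConvexStruct 𝒞) {A : X → L}
    (hA : A ∈ 𝒞) : (phi 𝒞 A ∘ fun x => (xi hC x).1) = A :=
  funext (phi_hull_single hC hA)

lemma phiF_comp_xi {X : Type v} {𝒞 : Set (X → L)} (hC : IsConvexStruct 𝒞) {A : X → L}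
    (hA : A ∈ 𝒞) : phiF 𝒞 A ∘ xi hC = A :=
  funext (phi_hull_single hC hA)

lemma Theta_subset_range {X : Type v} {𝒞 : Set (X → L)} (hC : IsConvexStruct 𝒞) :
    Theta 𝒞 ⊆ Set.range fun x => (xi hC x).1 :=
  fun _ ⟨x, hx⟩ => ⟨x, Subtype.ext hx.symm⟩

lemma Sober.s0 {X : Type v} {𝒞 : Set (X → L)} (h : Sober 𝒞) : S0 𝒞 :=
  fun x _ hxy => (h _ (nonemptyL_single x) (finL_single x)).unique rfl hxy

lemma xi_injective_iff {X : Type v} {𝒞 : Set (X → L)} (hC : IsConvexStruct 𝒞) :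
    Function.Injective (xi hC) ↔ S0 𝒞 := by
  simp only [Function.Injective, S0, xi, Subtype.mk.injEq]

/-- In a sober space, the principal convex sets are already F-closed. -/
lemma Sober.fClosed_Theta {X : Type v} {𝒞 : Set (X → L)} (hC : IsConvexStruct 𝒞)
    (h : Sober 𝒞) : FClosed (cpStruct 𝒞) (Theta 𝒞) := by
  intro G hG hGfin hGle K hK
  set f : X → cpT 𝒞 := fun x => (xi hC x).1
  have hf : Function.Injective f :=
    Subtype.val_injective.comp ((xi_injective_iff hC).mpr h.s0)
  have hzimg : zimg f (G ∘ f) = G := zimg_comp_of_le_chi_range hGle (Theta_subset_range hC)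
  obtain ⟨x, hx, -⟩ := h (G ∘ f) (nonemptyL_zimg_iff.mp (hzimg.symm ▸ hG))
    (FinL.of_zimg hf (hzimg.symm ▸ hGfin))
  refine ⟨x, eq_of_fsub_eq K.2.1 (hull_mem hC _) fun B hB => ?_⟩
  have hcp := isConvexStruct_cpStruct hC
  have hΦ : phi 𝒞 B ∈ cpStruct 𝒞 := ⟨B, hB, rfl⟩
  calc fsub K.1 B = fsub (single K) (phi 𝒞 B) := (fsub_single K (phi 𝒞 B)).symm
    _ = fsub G (phi 𝒞 B) := by rw [← fsub_hull hcp _ hΦ, ← hK, fsub_hull hcp _ hΦ]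
    _ = fsub (G ∘ f) B := by rw [← hzimg, fsub_zimg, phi_comp_xi hC hB, hzimg]
    _ = fsub (hull 𝒞 (single x)) B := by rw [← hx, fsub_hull hC _ hB]

lemma Sober.bijective_xi {X : Type v} {𝒞 : Set (X → L)} (hC : IsConvexStruct 𝒞)
    (h : Sober 𝒞) : Function.Bijective (xi hC) := by
  refine ⟨(xi_injective_iff hC).mpr h.s0, fun K => ?_⟩
  obtain ⟨x, hx⟩ := Set.mem_sInter.mp K.2 _ ⟨h.fClosed_Theta hC, subset_rfl⟩
  exact ⟨x, Subtype.ext (Subtype.ext hx.symm)⟩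

/-- The hull of a nonempty finite `L`-subset belongs to `X^F`. -/
lemma hull_mem_XF {X : Type v} {𝒞 : Set (X → L)} (hC : IsConvexStruct 𝒞) {F : X → L}
    (hF : NonemptyL F) (hFin : FinL F) :
    (⟨hull 𝒞 F, isCompactConvex_hull hC hF hFin⟩ : cpT 𝒞) ∈ XF 𝒞 := by
  refine Set.mem_sInter.mpr fun Z ⟨hZ, hZΘ⟩ => ?_
  refine hZ (zimg (fun x => (xi hC x).1) F) (nonemptyL_zimg_iff.mpr hF) (hFin.zimg _)
    (zimg_le_chi (fun x => hZΘ ⟨x, rfl⟩) F) _ (hull_eq_of_fsub_eq ?_)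
  rintro _ ⟨B, hB, rfl⟩
  rw [fsub_zimg, phi_comp_xi hC hB, fsub_single]
  exact (fsub_hull hC F hB).symm

lemma sober_of_bijective_xi {X : Type v} {𝒞 : Set (X → L)} (hC : IsConvexStruct 𝒞)
    (h : Function.Bijective (xi hC)) : Sober 𝒞 := by
  intro F hF hFin
  obtain ⟨x, hx⟩ := h.2 ⟨_, hull_mem_XF hC hF hFin⟩
  have hx' : hull 𝒞 (single x) = hull 𝒞 F := congrArg (fun K : XFT 𝒞 => K.1.1) hx
  exact ⟨x, hx'.symm, fun y hy => (xi_injective_iff hC).mp h.1 y x (hy.symm.trans hx'.symm)⟩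

lemma convPres_xi {X : Type v} {𝒞 : Set (X → L)} (hC : IsConvexStruct 𝒞) :
    ConvPres 𝒞 (xfStruct 𝒞) (xi hC) := by
  rintro _ ⟨A, hA, rfl⟩
  rwa [phiF_comp_xi hC hA]

lemma convToConv_xi {X : Type v} {𝒞 : Set (X → L)} (hC : IsConvexStruct 𝒞)
    (h : Function.Bijective (xi hC)) : ConvToConv 𝒞 (xfStruct 𝒞) (xi hC) := by
  refine fun A hA => ⟨A, hA, funext fun K => ?_⟩
  obtain ⟨x, rfl⟩ := h.2 K
  rw [zimg_apply_of_injective h.1]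
  exact (congrFun (phiF_comp_xi hC hA) x).symm

end CRL
open CRL in
/-- `X` is sober iff `ξ_X : X → X^F` is a convex-homeomorphism. -/
theorem stmt_9 {L : Type u} [CRL L] {X : Type v} {𝒞 : Set (X → L)}
    (hC : IsConvexStruct 𝒞) :
    Sober 𝒞 ↔
      (Function.Bijective (xi hC) ∧ ConvPres 𝒞 (xfStruct 𝒞) (xi hC) ∧
        ConvToConv 𝒞 (xfStruct 𝒞) (xi hC)) :=
  ⟨fun h => ⟨h.bijective_xi hC, convPres_xi hC, convToConv_xi hC (h.bijective_xi hC)⟩,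
    fun h => sober_of_bijective_xi hC h.1⟩
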